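/- Let μ ≥ ν > −1. The function x ↦ d_μ(x)/d_ν(x) is increasing on (0, α_{ν,1}). -/

import Mathlib

open Real Filter Set

/-- The Bessel function of the first kind of order `ν`, defined by its power series. -/
noncomputable def besselJ (ν x : ℝ) : ℝ :=
  ∑' n : ℕ, (-1 : ℝ) ^ n * x ^ (2 * (n : ℝ) + ν) /
    (2 ^ (2 * (n : ℝ) + ν) * (n.factorial : ℝ) * Real.Gamma ((n : ℝ) + ν + 1))

/-- The Dini function `d_ν(x) = (1-ν) J_ν(x) + x J_ν'(x) = J_ν(x) - x J_{ν+1}(x)`. -/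
noncomputable def dini (ν x : ℝ) : ℝ :=
  besselJ ν x - x * besselJ (ν + 1) x

/-- The `n`-th power series coefficient of the entire function `besselEntire ν`. -/
noncomputable def besselCoeff (ν : ℝ) (n : ℕ) : ℝ :=
  (-1 / 4) ^ n / ((n.factorial : ℝ) * Real.Gamma ((n : ℝ) + ν + 1))

/-- The entire function `h_ν` with `J_ν(x) = (x / 2) ^ ν * h_ν(x ^ 2)`. -/
noncomputable def besselEntire (ν z : ℝ) : ℝ :=
  ∑' n : ℕ, besselCoeff ν n * z ^ n

lemma succ_mul_besselCoeff_succ (ν : ℝ) (n : ℕ) :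
    ((n : ℝ) + 1) * besselCoeff ν (n + 1) = -(1 / 4) * besselCoeff (ν + 1) n := by
  have h : ((n + 1 : ℕ) : ℝ) + ν + 1 = n + (ν + 1) + 1 := by push_cast; ring
  have hn : (n : ℝ) + 1 ≠ 0 := by positivity
  simp only [besselCoeff, h, Nat.factorial_succ]
  push_cast
  rw [mul_assoc ((n : ℝ) + 1), ← mul_div_assoc, mul_div_mul_left _ _ hn, pow_succ]
  ring

lemma besselCoeff_eq_mul {ν : ℝ} (hν : -1 < ν) (n : ℕ) :
    besselCoeff ν n = ((n : ℝ) + ν + 1) * besselCoeff (ν + 1) n := by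
  have hn : (0 : ℝ) < n + ν + 1 := by have := n.cast_nonneg (α := ℝ); linarith
  have h : (n : ℝ) + (ν + 1) + 1 = (n + ν + 1) + 1 := by ring
  have hG := (Real.Gamma_pos_of_pos hn).ne'
  simp only [besselCoeff, h, Real.Gamma_add_one hn.ne']
  field_simp

lemma summable_besselCoeff {ν : ℝ} (hν : -1 < ν) (z : ℝ) :
    Summable fun n => besselCoeff ν n * z ^ n := by
  refine summable_of_ratio_norm_eventually_le (r := 1 / 2) (by norm_num) ?_
  obtain ⟨N, hN⟩ := exists_nat_ge (|z| + 1 + |ν|)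
  filter_upwards [eventually_ge_atTop N] with n hn
  have hn' : |z| + 1 + |ν| ≤ n := hN.trans (by exact_mod_cast hn)
  have hz := abs_nonneg z
  have hν' := neg_abs_le ν
  have h1 := succ_mul_besselCoeff_succ ν n
  rw [besselCoeff_eq_mul hν n]
  have h2 : besselCoeff ν (n + 1) = -(1 / 4) * besselCoeff (ν + 1) n / (n + 1) := by
    rw [← h1]; field_simp
  have hpos : (0 : ℝ) < n + ν + 1 := by linarith
  rw [h2]
  simp only [norm_mul, norm_div, Real.norm_eq_abs, abs_pow, pow_succ, abs_neg]
  rw [abs_of_pos hpos, abs_of_pos (by positivity : (0 : ℝ) < n + 1)]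
  have key : |z| ≤ 2 * ((n : ℝ) + ν + 1) * (n + 1) := by nlinarith
  have hC : 0 ≤ |besselCoeff (ν + 1) n| * |z| ^ n := by positivity
  have h3 : |(1 / 4 : ℝ)| = 1 / 4 := by norm_num
  rw [h3, div_mul_eq_mul_div, div_le_iff₀ (by positivity)]
  nlinarith [mul_le_mul_of_nonneg_left key hC]

lemma hasSum_besselEntire {ν : ℝ} (hν : -1 < ν) (z : ℝ) :
    HasSum (fun n => besselCoeff ν n * z ^ n) (besselEntire ν z) :=
  (summable_besselCoeff hν z).hasSum

lemma hasSum_nat_mul_besselCoeff {ν : ℝ} (hν : -1 < ν) (z : ℝ) :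
    HasSum (fun n : ℕ => n * besselCoeff ν n * z ^ n) (-(z / 4) * besselEntire (ν + 1) z) := by
  have h := (hasSum_besselEntire (by linarith : -1 < ν + 1) z).mul_left (-(z / 4))
  have h' : HasSum (fun n : ℕ => ((n + 1 : ℕ) : ℝ) * besselCoeff ν (n + 1) * z ^ (n + 1))
      (-(z / 4) * besselEntire (ν + 1) z) := by
    convert! h using 2 with n
    push_cast
    rw [succ_mul_besselCoeff_succ]
    ring
  simpa using HasSum.zero_add (f := fun n : ℕ => n * besselCoeff ν n * z ^ n) h'

lemma besselEntire_eq {ν : ℝ} (hν : -1 < ν) (z : ℝ) :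
    besselEntire ν z =
      (ν + 1) * besselEntire (ν + 1) z - z / 4 * besselEntire (ν + 1 + 1) z := by
  have hν' : -1 < ν + 1 := by linarith
  have h := ((hasSum_besselEntire hν' z).mul_left (ν + 1)).add (hasSum_nat_mul_besselCoeff hν' z)
  rw [sub_eq_add_neg, ← neg_mul]
  refine (hasSum_besselEntire hν z).unique ?_
  convert! h using 2 with n
  rw [besselCoeff_eq_mul hν n]
  ring

lemma hasDerivAt_besselEntire {ν : ℝ} (hν : -1 < ν) (z : ℝ) :
    HasDerivAt (besselEntire ν) (-(1 / 4) * besselEntire (ν + 1) z) z := by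
  have hν' : -1 < ν + 1 := by linarith
  set ρ := |z| + 1 with hρ
  have hterm (n : ℕ) (y : ℝ) : ((n + 1 : ℕ) : ℝ) * besselCoeff ν (n + 1) * y ^ n =
      -(1 / 4) * (besselCoeff (ν + 1) n * y ^ n) := by
    push_cast
    rw [succ_mul_besselCoeff_succ]
    ring
  have hsum : HasSum (fun n : ℕ => n * besselCoeff ν n * z ^ (n - 1))
      (-(1 / 4) * besselEntire (ν + 1) z) := by
    have h := (hasSum_besselEntire hν' z).mul_left (-(1 / 4))
    simp_rw [← hterm] at h
    simpa using HasSum.zero_add (f := fun n : ℕ => n * besselCoeff ν n * z ^ (n - 1)) h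
  have hbound : Summable fun n : ℕ => |n * besselCoeff ν n * ρ ^ (n - 1)| := by
    rw [← summable_nat_add_iff 1]
    simp only [Nat.add_sub_cancel, hterm]
    exact ((summable_besselCoeff hν' ρ).mul_left _).abs
  rw [← hsum.tsum_eq]
  refine hasDerivAt_tsum_of_isPreconnected (t := Metric.ball 0 ρ) (y₀ := z)
    (g := fun n z => besselCoeff ν n * z ^ n)
    (g' := fun n z => n * besselCoeff ν n * z ^ (n - 1)) hbound Metric.isOpen_ball
    (convex_ball _ _).isPreconnected ?_ ?_ ?_ (summable_besselCoeff hν z) ?_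
  · intro n y _
    convert! (hasDerivAt_pow n y).const_mul (besselCoeff ν n) using 1
    ring
  · intro n y hy
    rw [mem_ball_zero_iff, Real.norm_eq_abs] at hy
    simp only [Real.norm_eq_abs, abs_mul, abs_pow]
    rw [abs_of_pos (by positivity : 0 < ρ)]
    gcongr
  all_goals simp [hρ]

/-- The even entire function with `d_ν(x) = (x / 2) ^ ν * D_ν(x)`. -/
noncomputable def diniEntire (ν x : ℝ) : ℝ :=
  besselEntire ν (x ^ 2) - x ^ 2 / 2 * besselEntire (ν + 1) (x ^ 2)

lemma besselJ_eq {x : ℝ} (hx : 0 < x) (ν : ℝ) :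
    besselJ ν x = (x / 2) ^ ν * besselEntire ν (x ^ 2) := by
  rw [besselJ, besselEntire, ← tsum_mul_left]
  congr 1 with n
  have h (y : ℝ) (hy : 0 < y) : y ^ (2 * (n : ℝ) + ν) = (y ^ 2) ^ n * y ^ ν := by
    rw [Real.rpow_add hy, mul_comm 2 (n : ℝ), mul_comm (n : ℝ), Real.rpow_mul hy.le]
    norm_cast
  rw [h x hx, h 2 two_pos, Real.div_rpow hx.le two_pos.le, besselCoeff, div_pow (-1)]
  norm_num
  field_simp

lemma dini_eq {x : ℝ} (hx : 0 < x) (ν : ℝ) :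
    dini ν x = (x / 2) ^ ν * diniEntire ν x := by
  rw [dini, besselJ_eq hx, besselJ_eq hx, Real.rpow_add_one (by positivity), diniEntire]
  ring

lemma hasSum_diniEntire {ν : ℝ} (hν : -1 < ν) (x : ℝ) :
    HasSum (fun n : ℕ => (2 * n + 1) * besselCoeff ν n * (x ^ 2) ^ n) (diniEntire ν x) := by
  have h := (hasSum_besselEntire hν (x ^ 2)).add
    ((hasSum_nat_mul_besselCoeff hν (x ^ 2)).mul_left 2)
  have e : diniEntire ν x =
      besselEntire ν (x ^ 2) + 2 * (-(x ^ 2 / 4) * besselEntire (ν + 1) (x ^ 2)) := by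
    rw [diniEntire]; ring
  rw [e]
  convert! h using 2 with n
  ring

section Derivatives

variable {ν : ℝ}

lemma hasDerivAt_besselEntire_sq (hν : -1 < ν) (x : ℝ) :
    HasDerivAt (fun x => besselEntire ν (x ^ 2)) (-(x / 2) * besselEntire (ν + 1) (x ^ 2)) x := by
  convert! (hasDerivAt_besselEntire hν (x ^ 2)).comp x (hasDerivAt_pow 2 x) using 1
  push_cast
  ring

lemma hasDerivAt_diniEntire (hν : -1 < ν) (x : ℝ) :
    HasDerivAt (diniEntire ν)
      (x * ((ν - 1 / 2) * besselEntire (ν + 1) (x ^ 2) - besselEntire ν (x ^ 2))) x := by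
  have hν' : -1 < ν + 1 := by linarith
  convert! (hasDerivAt_besselEntire_sq hν x).sub
    (((hasDerivAt_pow 2 x).div_const 2).mul (hasDerivAt_besselEntire_sq hν' x)) using 1
  rw [besselEntire_eq hν]
  push_cast
  ring

lemma continuous_besselEntire_sq (hν : -1 < ν) : Continuous fun x => besselEntire ν (x ^ 2) :=
  continuous_iff_continuousAt.2 fun x => (hasDerivAt_besselEntire_sq hν x).continuousAt

lemma continuous_diniEntire (hν : -1 < ν) : Continuous (diniEntire ν) :=
  continuous_iff_continuousAt.2 fun x => (hasDerivAt_diniEntire hν x).continuousAt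

lemma besselEntire_zero_pos (hν : -1 < ν) : 0 < besselEntire ν 0 := by
  have h : besselEntire ν 0 = besselCoeff ν 0 * 0 ^ 0 :=
    tsum_eq_single 0 fun n hn => by simp [hn]
  rw [h]
  have := Real.Gamma_pos_of_pos (by linarith : 0 < ν + 1)
  simp [besselCoeff, this]

/-- `D_ν` is positive up to its first positive zero. -/
lemma diniEntire_pos (hν : -1 < ν) {a : ℝ} (ha : ∀ y ∈ Ioo 0 a, diniEntire ν y ≠ 0) {x : ℝ}
    (hx : x ∈ Ico 0 a) : 0 < diniEntire ν x := by
  have h0 : 0 < diniEntire ν 0 := by simpa [diniEntire] using besselEntire_zero_pos hν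
  by_contra! hneg
  obtain ⟨y, hy, hy0⟩ := intermediate_value_Icc' hx.1 (continuous_diniEntire hν).continuousOn
    ⟨hneg, h0.le⟩
  have hy_pos : 0 < y := hy.1.lt_of_ne fun h => h0.ne' (h ▸ hy0)
  exact ha y ⟨hy_pos, hy.2.trans_lt hx.2⟩ hy0

lemma besselEntire_sq_pos (hν : -1 < ν) {a : ℝ} (ha : ∀ y ∈ Ico 0 a, 0 < diniEntire ν y) {x : ℝ}
    (hx : x ∈ Ioo 0 a) : 0 < besselEntire ν (x ^ 2) := by
  have hd (y : ℝ) : HasDerivAt (fun y => y * besselEntire ν (y ^ 2)) (diniEntire ν y) y := by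
    convert! (hasDerivAt_id y).mul (hasDerivAt_besselEntire_sq hν y) using 1
    simp only [diniEntire, id]
    ring
  have hmono : StrictMonoOn (fun y => y * besselEntire ν (y ^ 2)) (Icc 0 x) := by
    refine strictMonoOn_of_deriv_pos (convex_Icc _ _)
      (fun y _ => (hd y).continuousAt.continuousWithinAt) fun y hy => ?_
    rw [interior_Icc] at hy
    rw [(hd y).deriv]
    exact ha y ⟨hy.1.le, hy.2.trans hx.2⟩
  have h := hmono (left_mem_Icc.2 hx.1.le) (right_mem_Icc.2 hx.1.le) hx.1
  exact pos_of_mul_pos_right (by simpa using h) hx.1.le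

/-- A multiple of `-(θ(θJ_ν / J_ν)) J_ν²`, where `θ = x d/dx`. -/
noncomputable def besselTuran (ν x : ℝ) : ℝ :=
  x ^ 2 / 4 * besselEntire (ν + 1) (x ^ 2) ^ 2
    - ν * besselEntire (ν + 1) (x ^ 2) * besselEntire ν (x ^ 2) + besselEntire ν (x ^ 2) ^ 2

lemma hasDerivAt_rpow_mul_besselTuran (hν : -1 < ν) {x : ℝ} (hx : 0 < x) :
    HasDerivAt (fun x => x ^ (2 * ν + 2) * besselTuran ν x)
      (2 * x ^ (2 * ν + 1) * besselEntire ν (x ^ 2) ^ 2) x := by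
  have hν' : -1 < ν + 1 := by linarith
  have hp : HasDerivAt (fun x : ℝ => x ^ (2 * ν + 2)) _ x :=
    Real.hasDerivAt_rpow_const (Or.inl hx.ne')
  have hH := hasDerivAt_besselEntire_sq hν x
  have hK := hasDerivAt_besselEntire_sq hν' x
  convert! hp.mul (((((hasDerivAt_pow 2 x).div_const 4).mul (hK.pow 2)).sub
    ((hK.const_mul ν).mul hH)).add (hH.pow 2)) using 1
  have e1 : x ^ (2 * ν + 2 - 1) = x ^ (2 * ν + 1) := by congr 1; ring
  have e2 : x ^ (2 * ν + 2) = x ^ (2 * ν + 1) * x := by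
    rw [← Real.rpow_add_one hx.ne']; congr 1; ring
  simp only [e1, e2, besselEntire_eq hν, Pi.mul_apply, Pi.sub_apply, Pi.add_apply, Pi.pow_apply]
  push_cast
  ring

lemma continuous_besselTuran (hν : -1 < ν) : Continuous (besselTuran ν) := by
  have hH := continuous_besselEntire_sq hν
  have hK := continuous_besselEntire_sq (by linarith : -1 < ν + 1)
  unfold besselTuran
  fun_prop

lemma besselTuran_nonneg (hν : -1 < ν) {x : ℝ} (hx : 0 < x) : 0 ≤ besselTuran ν x := by
  have hp : Continuous fun x : ℝ => x ^ (2 * ν + 2) := Real.continuous_rpow_const (by linarith)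
  have hmono : MonotoneOn (fun x => x ^ (2 * ν + 2) * besselTuran ν x) (Ici 0) := by
    refine monotoneOn_of_hasDerivWithinAt_nonneg (convex_Ici 0)
      (f' := fun x => 2 * x ^ (2 * ν + 1) * besselEntire ν (x ^ 2) ^ 2)
      (hp.mul (continuous_besselTuran hν)).continuousOn ?_ ?_
    all_goals
      intro y hy
      rw [interior_Ici, mem_Ioi] at hy
    · exact (hasDerivAt_rpow_mul_besselTuran hν hy).hasDerivWithinAt
    · positivity
  have h := hmono self_mem_Ici (mem_Ici.2 hx.le) hx.le
  have h0 : (0 : ℝ) ^ (2 * ν + 2) = 0 := Real.zero_rpow (by linarith)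
  simp only [h0, zero_mul] at h
  exact nonneg_of_mul_nonneg_right h (by positivity)

/-- A positive multiple of the derivative of `x D_ν'(x) / D_ν(x)`. -/
noncomputable def diniTuran (ν x : ℝ) : ℝ :=
  (2 * ν - 1 - x ^ 2) * besselTuran ν x - 2 * (besselEntire ν (x ^ 2) * diniEntire ν x)

lemma hasDerivAt_rpow_mul_diniTuran_div (hν : -1 < ν) {x : ℝ} (hx : 0 < x)
    (hc : 2 * ν - 1 - x ^ 2 ≠ 0) :
    HasDerivAt (fun x => x ^ (2 * ν + 2) * besselTuran ν x
        - 2 * x ^ (2 * ν + 2) * (besselEntire ν (x ^ 2) * diniEntire ν x) / (2 * ν - 1 - x ^ 2))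
      (-(2 * x ^ (2 * ν + 1) * ((2 * ν - 1 - x ^ 2) * diniEntire ν x ^ 2
        + 2 * (2 * ν - 1) * (diniEntire ν x * besselEntire ν (x ^ 2)))
          / (2 * ν - 1 - x ^ 2) ^ 2)) x := by
  have hp : HasDerivAt (fun x : ℝ => x ^ (2 * ν + 2)) _ x :=
    Real.hasDerivAt_rpow_const (Or.inl hx.ne')
  have hH := hasDerivAt_besselEntire_sq hν x
  have hD := hasDerivAt_diniEntire hν x
  have hcd := (hasDerivAt_pow 2 x).const_sub (2 * ν - 1)
  convert! (hasDerivAt_rpow_mul_besselTuran hν hx).sub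
    (((hp.const_mul 2).mul (hH.mul hD)).div hcd hc) using 1
  have e1 : x ^ (2 * ν + 2 - 1) = x ^ (2 * ν + 1) := by congr 1; ring
  have e2 : x ^ (2 * ν + 2) = x ^ (2 * ν + 1) * x := by
    rw [← Real.rpow_add_one hx.ne']; congr 1; ring
  simp only [e1, e2, Pi.mul_apply, diniEntire]
  push_cast
  field_simp
  ring

lemma diniTuran_nonpos (hν : -1 < ν) {a : ℝ} (ha : ∀ y ∈ Ico 0 a, 0 < diniEntire ν y) {x : ℝ}
    (hx : x ∈ Ioo 0 a) : diniTuran ν x ≤ 0 := by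
  have hR := besselTuran_nonneg hν hx.1
  have hHpos {y : ℝ} (hy : y ∈ Ioo 0 a) := besselEntire_sq_pos hν ha hy
  have hDpos {y : ℝ} (hy : y ∈ Ioo 0 a) := ha y ⟨hy.1.le, hy.2⟩
  have hHD := mul_pos (hHpos hx) (hDpos hx)
  rcases le_or_gt (2 * ν - 1 - x ^ 2) 0 with hc | hc
  · rw [diniTuran]
    linarith [mul_nonpos_of_nonpos_of_nonneg hc hR]
  have hcy {y : ℝ} (hy : y ∈ Icc 0 x) : 0 < 2 * ν - 1 - y ^ 2 := by
    have := pow_le_pow_left₀ hy.1 hy.2 2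
    linarith
  have hν1 : 0 < 2 * ν - 1 := by simpa using hcy (left_mem_Icc.2 hx.1.le)
  have hp : Continuous fun x : ℝ => x ^ (2 * ν + 2) := Real.continuous_rpow_const (by linarith)
  have hH := continuous_besselEntire_sq hν
  have hD := continuous_diniEntire hν
  have hRc := continuous_besselTuran hν
  have hanti : AntitoneOn (fun x => x ^ (2 * ν + 2) * besselTuran ν x
      - 2 * x ^ (2 * ν + 2) * (besselEntire ν (x ^ 2) * diniEntire ν x) / (2 * ν - 1 - x ^ 2))
      (Icc 0 x) := by
    have hd {y : ℝ} (hy : y ∈ interior (Icc 0 x)) := hasDerivAt_rpow_mul_diniTuran_div hν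
      (x := y) (by rw [interior_Icc] at hy; exact hy.1) (hcy (interior_subset hy)).ne'
    refine antitoneOn_of_deriv_nonpos (convex_Icc 0 x) ?_
      (fun y hy => (hd hy).differentiableAt.differentiableWithinAt) fun y hy => ?_
    · refine ContinuousOn.sub (by fun_prop) (ContinuousOn.div (by fun_prop) (by fun_prop) ?_)
      exact fun y hy => (hcy hy).ne'
    · rw [(hd hy).deriv]
      have hcy' := hcy (interior_subset hy)
      rw [interior_Icc] at hy
      have hya : y ∈ Ioo 0 a := ⟨hy.1, hy.2.trans hx.2⟩
      have := hHpos hya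
      have := hDpos hya
      have := hy.1
      rw [neg_nonpos]
      positivity
  have h := hanti (left_mem_Icc.2 hx.1.le) (right_mem_Icc.2 hx.1.le) hx.1.le
  have h0 : (0 : ℝ) ^ (2 * ν + 2) = 0 := Real.zero_rpow (by linarith)
  simp only [h0, zero_mul, mul_zero, zero_div, sub_zero] at h
  have e : x ^ (2 * ν + 2) * besselTuran ν x
      - 2 * x ^ (2 * ν + 2) * (besselEntire ν (x ^ 2) * diniEntire ν x) / (2 * ν - 1 - x ^ 2)
      = x ^ (2 * ν + 2) / (2 * ν - 1 - x ^ 2) * diniTuran ν x := by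
    rw [diniTuran]
    field_simp
  rw [e] at h
  exact nonpos_of_mul_nonpos_right h (div_pos (Real.rpow_pos_of_pos hx.1 _) hc)

lemma antitoneOn_mul_deriv_div_diniEntire (hν : -1 < ν) {a : ℝ}
    (ha : ∀ y ∈ Ico 0 a, 0 < diniEntire ν y) :
    AntitoneOn (fun x => x * deriv (diniEntire ν) x / diniEntire ν x) (Ioo 0 a) := by
  have hν' : -1 < ν + 1 := by linarith
  have hd {x : ℝ} (hx : x ∈ Ioo 0 a) :
      HasDerivAt (fun x => x * deriv (diniEntire ν) x / diniEntire ν x)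
        (x * diniTuran ν x / diniEntire ν x ^ 2) x := by
    have hderiv : deriv (diniEntire ν) = fun x =>
        x * ((ν - 1 / 2) * besselEntire (ν + 1) (x ^ 2) - besselEntire ν (x ^ 2)) :=
      funext fun x => (hasDerivAt_diniEntire hν x).deriv
    rw [hderiv]
    have hD := (ha x ⟨hx.1.le, hx.2⟩).ne'
    convert! ((hasDerivAt_id x).mul ((hasDerivAt_id x).mul
      (((hasDerivAt_besselEntire_sq hν' x).const_mul (ν - 1 / 2)).sub
        (hasDerivAt_besselEntire_sq hν x)))).div (hasDerivAt_diniEntire hν x) hD using 1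
    congr 1
    simp only [id, Pi.mul_apply, Pi.sub_apply, diniTuran, besselTuran, diniEntire,
      besselEntire_eq hν]
    ring
  refine antitoneOn_of_deriv_nonpos (convex_Ioo 0 a)
    (fun x hx => (hd hx).continuousAt.continuousWithinAt) ?_ ?_
  all_goals
    intro x hx
    rw [interior_Ioo] at hx
  · exact (hd hx).differentiableAt.differentiableWithinAt
  · rw [(hd hx).deriv]
    exact div_nonpos_of_nonpos_of_nonneg
      (mul_nonpos_of_nonneg_of_nonpos hx.1.le (diniTuran_nonpos hν ha hx)) (sq_nonneg _)

lemma monotoneOn_diniEntire_mul_div (hν : -1 < ν) {a : ℝ}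
    (ha : ∀ y ∈ Ico 0 a, 0 < diniEntire ν y) {t : ℝ} (ht : t ∈ Ioo (0 : ℝ) 1) :
    MonotoneOn (fun x => diniEntire ν (t * x) / diniEntire ν x) (Ioo 0 a) := by
  have hdiff (x : ℝ) : HasDerivAt (diniEntire ν) (deriv (diniEntire ν) x) x :=
    (hasDerivAt_diniEntire hν x).differentiableAt.hasDerivAt
  have hd {x : ℝ} (hx : x ∈ Ioo 0 a) := ((hdiff (t * x)).comp x
    ((hasDerivAt_id x).const_mul t)).div (hdiff x) (ha x ⟨hx.1.le, hx.2⟩).ne'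
  refine monotoneOn_of_hasDerivWithinAt_nonneg (convex_Ioo 0 a)
    (fun x hx => (hd hx).continuousAt.continuousWithinAt)
    (fun x hx => (hd (interior_subset hx)).hasDerivWithinAt) fun x hx => ?_
  rw [interior_Ioo] at hx
  have htx : t * x < x := mul_lt_of_lt_one_left hx.1 ht.2
  have htx0 : 0 < t * x := mul_pos ht.1 hx.1
  have hanti := antitoneOn_mul_deriv_div_diniEntire hν ha ⟨htx0, htx.trans hx.2⟩ hx htx.le
  have h1 := ha x ⟨hx.1.le, hx.2⟩
  have h2 := ha (t * x) ⟨htx0.le, htx.trans hx.2⟩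
  rw [div_le_div_iff₀ h1 h2] at hanti
  refine div_nonneg (nonneg_of_mul_nonneg_right ?_ hx.1) (sq_nonneg _)
  simp only [Function.comp_apply, mul_one]
  linarith

end Derivatives

section BetaMoments

open MeasureTheory ProbabilityTheory

variable {α β : ℝ}

lemma ae_betaMeasure_mem_Ioo (α β : ℝ) : ∀ᵐ t ∂betaMeasure α β, t ∈ Ioo (0 : ℝ) 1 := by
  have hm : Measurable (betaPDF α β) := (measurable_betaPDFReal α β).ennreal_ofReal
  rw [betaMeasure, ae_withDensity_iff hm]
  refine Eventually.of_forall fun t ht => ?_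
  by_contra h
  exact ht (by rw [betaPDF_eq, if_neg (show ¬(0 < t ∧ t < 1) from h), ENNReal.ofReal_zero])

lemma integral_betaMeasure (hα : 0 < α) (hβ : 0 < β) (f : ℝ → ℝ) :
    ∫ t, f t ∂betaMeasure α β = ∫ t, betaPDFReal α β t * f t := by
  have hm : Measurable (betaPDF α β) := (measurable_betaPDFReal α β).ennreal_ofReal
  rw [betaMeasure, integral_withDensity_eq_integral_toReal_smul hm
    (Eventually.of_forall fun _ => ENNReal.ofReal_lt_top)]
  refine integral_congr_ae (Eventually.of_forall fun t => ?_)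
  have h0 : 0 ≤ betaPDFReal α β t := by
    by_cases ht : 0 < t ∧ t < 1
    · exact (betaPDFReal_pos ht.1 ht.2 hα hβ).le
    · rw [betaPDFReal, if_neg ht]
  simp only [betaPDF, ENNReal.toReal_ofReal h0, smul_eq_mul]

lemma integral_pow_betaMeasure (hα : 0 < α) (hβ : 0 < β) (n : ℕ) :
    ∫ t, t ^ n ∂betaMeasure α β = beta (α + n) β / beta α β := by
  have hαn : 0 < α + n := by positivity
  have hone : ∫ t, betaPDFReal (α + n) β t = 1 := by
    have := isProbabilityMeasureBeta hαn hβ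
    simpa using (integral_betaMeasure hαn hβ fun _ => 1).symm
  rw [integral_betaMeasure hα hβ, ← mul_one (beta (α + n) β / beta α β), ← hone,
    ← integral_const_mul]
  congr 1 with t
  have h1 := (beta_pos hα hβ).ne'
  have h2 := (beta_pos hαn hβ).ne'
  by_cases ht : 0 < t ∧ t < 1
  · have e : t ^ (α + n - 1) = t ^ (α - 1) * t ^ n := by
      rw [← Real.rpow_natCast, ← Real.rpow_add ht.1]; congr 1; ring
    simp only [betaPDFReal, if_pos ht, e]
    field_simp
  · simp [betaPDFReal, ht]

lemma integrable_pow_betaMeasure (hα : 0 < α) (hβ : 0 < β) (n : ℕ) :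
    Integrable (fun t => t ^ n) (betaMeasure α β) := by
  have := isProbabilityMeasureBeta hα hβ
  refine Integrable.of_bound (by fun_prop) 1 ?_
  filter_upwards [ae_betaMeasure_mem_Ioo α β] with t ht
  rw [norm_pow, Real.norm_of_nonneg ht.1.le]
  exact pow_le_one₀ ht.1.le ht.2.le

/-- Sonine's integral: `D_μ` is a Beta average of dilates of `D_ν`. -/
lemma integral_diniEntire {μ ν : ℝ} (hν : -1 < ν) (hμν : ν < μ) (x : ℝ) :
    Real.Gamma (μ + 1) / Real.Gamma (ν + 1) * diniEntire μ x =
      ∫ t, diniEntire ν (√t * x) ∂betaMeasure (ν + 1) (μ - ν) := by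
  have hα : 0 < ν + 1 := by linarith
  have hβ : 0 < μ - ν := by linarith
  set P := betaMeasure (ν + 1) (μ - ν)
  have := isProbabilityMeasureBeta hα hβ
  set c : ℕ → ℝ := fun n => (2 * n + 1) * besselCoeff ν n * (x ^ 2) ^ n with hc
  have hsum : Summable c := (hasSum_diniEntire hν x).summable
  have hint (n : ℕ) : Integrable (fun t => c n * t ^ n) P :=
    (integrable_pow_betaMeasure hα hβ n).const_mul (c n)
  have hnorm : Summable fun n => ∫ t, ‖c n * t ^ n‖ ∂P := by
    refine hsum.abs.of_nonneg_of_le (fun n => integral_nonneg fun t => norm_nonneg _) fun n => ?_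
    have hle : ∀ᵐ t ∂P, ‖c n * t ^ n‖ ≤ |c n| := by
      filter_upwards [ae_betaMeasure_mem_Ioo (ν + 1) (μ - ν)] with t ht
      rw [norm_mul, norm_pow, Real.norm_of_nonneg ht.1.le]
      exact mul_le_of_le_one_right (abs_nonneg _) (pow_le_one₀ ht.1.le ht.2.le)
    simpa [P] using integral_mono_ae (hint n).norm (integrable_const _) hle
  have h := hasSum_integral_of_summable_integral_norm hint hnorm
  have hrhs : ∫ t, ∑' n, c n * t ^ n ∂P = ∫ t, diniEntire ν (√t * x) ∂P := by
    refine integral_congr_ae ?_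
    filter_upwards [ae_betaMeasure_mem_Ioo (ν + 1) (μ - ν)] with t ht
    rw [← (hasSum_diniEntire hν _).tsum_eq]
    congr 1 with n
    rw [mul_pow, Real.sq_sqrt ht.1.le, mul_pow]
    simp only [hc]
    ring
  rw [← hrhs]
  refine HasSum.unique ?_ h
  convert! (hasSum_diniEntire (hν.trans hμν) x).mul_left
    (Real.Gamma (μ + 1) / Real.Gamma (ν + 1)) using 2 with n
  have hn := n.cast_nonneg (α := ℝ)
  rw [integral_const_mul, integral_pow_betaMeasure hα hβ]
  have e1 : ν + 1 + n = n + ν + 1 := by ring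
  have e2 : n + ν + 1 + (μ - ν) = n + μ + 1 := by ring
  have e3 : ν + 1 + (μ - ν) = μ + 1 := by ring
  have h1 := (Real.Gamma_pos_of_pos (by linarith : 0 < n + ν + 1)).ne'
  have h2 := (Real.Gamma_pos_of_pos (by linarith : 0 < n + μ + 1)).ne'
  have h3 := (Real.Gamma_pos_of_pos hα).ne'
  have h4 := (Real.Gamma_pos_of_pos hβ).ne'
  simp only [beta, hc, besselCoeff, e1, e2, e3]
  field_simp

lemma diniEntire_div_nonneg_and_monotoneOn {μ ν : ℝ} (hν : -1 < ν) (hμν : ν < μ) {a : ℝ}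
    (ha : ∀ y ∈ Ico 0 a, 0 < diniEntire ν y) :
    (∀ x ∈ Ioo 0 a, 0 ≤ diniEntire μ x / diniEntire ν x) ∧
      MonotoneOn (fun x => diniEntire μ x / diniEntire ν x) (Ioo 0 a) := by
  have hα : 0 < ν + 1 := by linarith
  have hβ : 0 < μ - ν := by linarith
  have := isProbabilityMeasureBeta hα hβ
  have hC : 0 < Real.Gamma (μ + 1) / Real.Gamma (ν + 1) :=
    div_pos (Real.Gamma_pos_of_pos (by linarith)) (Real.Gamma_pos_of_pos hα)
  have hmem {t x : ℝ} (ht : t ∈ Ioo (0 : ℝ) 1) (hx : x ∈ Ioo 0 a) : √t * x ∈ Ico 0 a :=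
    ⟨mul_nonneg (Real.sqrt_nonneg t) hx.1.le, (mul_lt_of_lt_one_left hx.1
      ((Real.sqrt_lt' one_pos).2 (by simpa using ht.2))).trans hx.2⟩
  have hrep (x : ℝ) : Real.Gamma (μ + 1) / Real.Gamma (ν + 1) *
      (diniEntire μ x / diniEntire ν x) =
        ∫ t, diniEntire ν (√t * x) / diniEntire ν x ∂betaMeasure (ν + 1) (μ - ν) := by
    rw [integral_div, ← integral_diniEntire hν hμν, mul_div_assoc]
  have hcont := continuous_diniEntire hν
  have hint {x : ℝ} : Integrable (fun t => diniEntire ν (√t * x) / diniEntire ν x)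
      (betaMeasure (ν + 1) (μ - ν)) := by
    refine Integrable.div_const ?_ _
    have hg : Continuous fun t => diniEntire ν (√t * x) := by fun_prop
    obtain ⟨C, hC⟩ := (isCompact_Icc (a := (0 : ℝ)) (b := 1)).exists_bound_of_continuousOn
      hg.continuousOn
    refine Integrable.of_bound hg.aestronglyMeasurable C ?_
    filter_upwards [ae_betaMeasure_mem_Ioo (ν + 1) (μ - ν)] with t ht
    exact hC t ⟨ht.1.le, ht.2.le⟩
  refine ⟨fun x hx => nonneg_of_mul_nonneg_right ?_ hC, fun x hx y hy hxy =>
    le_of_mul_le_mul_left ?_ hC⟩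
  · rw [hrep]
    refine integral_nonneg_of_ae ?_
    filter_upwards [ae_betaMeasure_mem_Ioo (ν + 1) (μ - ν)] with t ht
    exact div_nonneg (ha _ (hmem ht hx)).le (ha x ⟨hx.1.le, hx.2⟩).le
  · simp only [hrep]
    refine integral_mono_ae hint hint ?_
    filter_upwards [ae_betaMeasure_mem_Ioo (ν + 1) (μ - ν)] with t ht
    exact monotoneOn_diniEntire_mul_div hν ha
      ⟨Real.sqrt_pos.2 ht.1, (Real.sqrt_lt' one_pos).2 (by simpa using ht.2)⟩ hx hy hxy

end BetaMoments

/-- Let `μ ≥ ν > -1` and let `a1 = α_{ν,1}` be the first positive zero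
of the Dini function `d_ν`.  Then the function `x ↦ d_μ(x)/d_ν(x)` is increasing on
`(0, a1)`. -/
theorem dini_quotient_increasing (μ ν : ℝ) (hν : -1 < ν) (hμν : ν ≤ μ)
    (a1 : ℝ) (ha1pos : 0 < a1) (ha1zero : dini ν a1 = 0)
    (ha1min : ∀ y : ℝ, 0 < y → dini ν y = 0 → a1 ≤ y) :
    MonotoneOn (fun x : ℝ => dini μ x / dini ν x) (Set.Ioo (0 : ℝ) a1) := by
  have hne : ∀ y ∈ Ioo 0 a1, diniEntire ν y ≠ 0 := fun y hy h =>
    (ha1min y hy.1 (by rw [dini_eq hy.1, h, mul_zero])).not_gt hy.2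
  have hpos : ∀ y ∈ Ico 0 a1, 0 < diniEntire ν y := fun y hy => diniEntire_pos hν hne hy
  rcases hμν.eq_or_lt with rfl | hlt
  · intro x hx y hy _
    have hdini {z : ℝ} (hz : z ∈ Ioo 0 a1) : dini ν z ≠ 0 := fun h =>
      (ha1min z hz.1 h).not_gt hz.2
    simp only [div_self (hdini hx), div_self (hdini hy), le_refl]
  · obtain ⟨hnonneg, hmono⟩ := diniEntire_div_nonneg_and_monotoneOn hν hlt hpos
    have hrpow : MonotoneOn (fun x : ℝ => (x / 2) ^ (μ - ν)) (Ioo 0 a1) := fun x hx y _ hxy =>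
      Real.rpow_le_rpow (by linarith [hx.1]) (by linarith) (by linarith)
    refine (hrpow.mul hmono (fun x hx => ?_) hnonneg).congr fun x hx => ?_
    · exact Real.rpow_nonneg (by linarith [hx.1]) _
    · have hx2 : 0 < x / 2 := half_pos hx.1
      simp only [Pi.mul_apply, dini_eq hx.1, mul_div_mul_comm, Real.rpow_sub hx2]
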